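/- Let V be a 2n-dimensional real inner product space (n ≥ 4) with orthogonal complex structure J, N a 2-dimensional inner product space, and α: V × V → N symmetric bilinear such that the curvature tensor R defined by the Gauss equation with c = -1 satisfies the Kaehler identity R(X,Y)∘J = J∘R(X,Y). Suppose further that α is not identically such that R ≡ 0 (no flat point). Then there exists a unit vector δ ∈ N with A_δ = I, i.e., ⟨α(X,Y), δ⟩ = ⟨X,Y⟩ for all X, Y ∈ V. -/

import Mathlib

open scoped RealInnerProductSpace

/-- The (4,0)-curvature tensor `⟨R(X,Y)Z,W⟩` determined by the Gauss equation in a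
space form of curvature `c`. -/
noncomputable def gaussR {V N : Type*} [NormedAddCommGroup V] [InnerProductSpace ℝ V]
    [NormedAddCommGroup N] [InnerProductSpace ℝ N]
    (c : ℝ) (α : V →ₗ[ℝ] V →ₗ[ℝ] N) (X Y Z W : V) : ℝ :=
  c * (⟪Y, Z⟫ * ⟪X, W⟫ - ⟪X, Z⟫ * ⟪Y, W⟫) + ⟪α X W, α Y Z⟫ - ⟪α X Z, α Y W⟫

lemma four_vec (x y : Fin 4 → ℝ) (h : ∀ i j, i ≠ j → x i * x j + y i * y j = 1) :
    ∃ k, x k ^ 2 + y k ^ 2 = 1 := by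
  have h01 := h 0 1 (by decide)
  have h02 := h 0 2 (by decide)
  have h03 := h 0 3 (by decide)
  have h12 := h 1 2 (by decide)
  have h13 := h 1 3 (by decide)
  have h23 := h 2 3 (by decide)
  by_cases hx : x 0 = x 1 ∧ y 0 = y 1
  · refine ⟨0, ?_⟩
    rw [← hx.1, ← hx.2] at h01
    linarith
  · refine ⟨2, ?_⟩
    have hdet : x 2 * y 3 - x 3 * y 2 = 0 := by
      by_contra hne
      apply hx
      constructor
      · have : (x 0 - x 1) * (x 2 * y 3 - x 3 * y 2) = 0 := by
          linear_combination y 3 * (h02 - h12) - y 2 * (h03 - h13)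
        rcases mul_eq_zero.1 this with h | h
        · linarith
        · exact absurd h hne
      · have : (y 0 - y 1) * (x 2 * y 3 - x 3 * y 2) = 0 := by
          linear_combination x 2 * (h03 - h13) - x 3 * (h02 - h12)
        rcases mul_eq_zero.1 this with h | h
        · linarith
        · exact absurd h hne
    have e1 : x 2 = x 3 := by
      linear_combination y 0 * hdet - x 2 * h03 + x 3 * h02
    have e2 : y 2 = y 3 := by
      linear_combination - x 0 * hdet - y 2 * h03 + y 3 * h02
    rw [← e1, ← e2] at h23
    linarith

lemma exists_other {n : ℕ} (hn : 4 ≤ n) (i j : Fin n) : ∃ k l : Fin n,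
    k ≠ i ∧ k ≠ j ∧ l ≠ i ∧ l ≠ j ∧ k ≠ l := by
  have hc : 2 ≤ (Finset.univ \ {i, j} : Finset (Fin n)).card := by
    have h1 := Finset.le_card_sdiff ({i, j} : Finset (Fin n)) Finset.univ
    have h2 : ({i, j} : Finset (Fin n)).card ≤ 2 := Finset.card_le_two
    simp only [Finset.card_univ, Fintype.card_fin] at h1
    omega
  obtain ⟨k, hk, l, hl, hkl⟩ := Finset.one_lt_card.1 hc
  simp at hk hl
  exact ⟨k, l, hk.1, hk.2, hl.1, hl.2, hkl⟩

lemma mat_core {n : ℕ} (hn : 4 ≤ n) (a : Fin n → ℝ) (b : Fin n → Fin n → ℂ)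
    (hb : ∀ i j, b j i = (starRingEnd ℂ) (b i j))
    (hd : ∀ i j, i ≠ j → (a i : ℂ) * a j + b i i * b j j - 1 = b i j * b j i)
    (ho : ∀ i j k l, i ≠ j → ¬ (i = k ∧ j = l) → ¬ (i = l ∧ j = k) →
      b i k * b j l = b i l * b j k) :
    ∃ c s : ℝ, c ^ 2 + s ^ 2 = 1 ∧ ∀ i j,
      (c : ℂ) * (if i = j then (a i : ℂ) else 0) + s * b i j = if i = j then 1 else 0 := by
  by_cases hdiag : ∀ i j, i ≠ j → b i j = 0
  · have hre : ∀ i, b i i = ((b i i).re : ℂ) := fun i =>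
      (Complex.conj_eq_iff_re.1 (hb i i).symm).symm
    have hr : ∀ i j, i ≠ j → a i * a j + (b i i).re * (b j j).re = 1 := by
      intro i j hij
      have := hd i j hij
      rw [hdiag i j hij, zero_mul, hre i, hre j] at this
      have h2 : ((a i * a j + (b i i).re * (b j j).re - 1 : ℝ) : ℂ) = ((0 : ℝ) : ℂ) := by
        push_cast; exact this
      have := Complex.ofReal_injective h2
      linarith
    obtain ⟨k, hk⟩ := four_vec (fun i => a (Fin.castLE hn i))
      (fun i => (b (Fin.castLE hn i) (Fin.castLE hn i)).re)
      (fun i j hij => hr _ _ (fun h => hij (Fin.castLE_injective hn h)))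
    set kz := Fin.castLE hn k
    refine ⟨a kz, (b kz kz).re, hk, fun i j => ?_⟩
    by_cases hij : i = j
    · subst hij
      simp only [if_true]
      rw [hre i]
      by_cases hki : kz = i
      · subst hki
        have : ((a kz ^ 2 + (b kz kz).re ^ 2 : ℝ) : ℂ) = ((1 : ℝ) : ℂ) := by rw [hk]
        push_cast at this
        linear_combination this
      · have : ((a kz * a i + (b kz kz).re * (b i i).re : ℝ) : ℂ) = ((1 : ℝ) : ℂ) := by
          rw [hr _ _ hki]
        push_cast at this
        linear_combination this
    · simp [hij, hdiag i j hij]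
  · push Not at hdiag
    obtain ⟨i, j, hij, hne⟩ := hdiag
    have key : ∀ m r, m ≠ r → a m * a r = 1 := by
      by_cases hdet : b i i * b j j - b i j * b j i = 0
      · have hall : ∀ m l, b i j * b m l = b i l * b m j := by
          intro m l
          by_cases hm : i = m
          · subst hm; ring
          by_cases hl : j = l
          · subst hl; ring
          by_cases hx : i = l ∧ m = j
          · obtain ⟨rfl, rfl⟩ := hx
            linear_combination -hdet
          · exact ho i m j l hm (fun h => hij h.1) hx
        intro m r hmr
        have h1 : b i j * b i j * (b m m * b r r - b m r * b r m) = 0 := by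
          linear_combination (b i j * b r r) * hall m m + (b i m * b m j) * hall r r
            - (b i j * b r m) * hall m r - (b i r * b m j) * hall r m
        have h2 : b m m * b r r - b m r * b r m = 0 := by
          rcases mul_eq_zero.1 h1 with h | h
          · exact absurd h (mul_ne_zero hne hne)
          · exact h
        have h3 : ((a m * a r : ℝ) : ℂ) = ((1 : ℝ) : ℂ) := by
          push_cast
          linear_combination hd m r hmr - h2
        exact Complex.ofReal_injective h3
      · exfalso
        obtain ⟨k, l, hki, hkj, hli, hlj, hkl⟩ := exists_other hn i j
        have hik : ∀ k, k ≠ i → k ≠ j → b i k = 0 ∧ b j k = 0 ∧ b k i = 0 ∧ b k j = 0 := by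
          intro k hki hkj
          have e1 := ho i j j k hij (fun h => hij h.1) (fun h => hki h.1.symm)
          have e2 := ho i j i k hij (fun h => hkj h.2.symm) (fun h => hki h.1.symm)
          have h1 : b i k = 0 := by
            have : (b i i * b j j - b i j * b j i) * b i k = 0 := by
              linear_combination -b i i * e1 + b i j * e2
            exact (mul_eq_zero.1 this).resolve_left hdet
          have h2 : b j k = 0 := by
            rw [h1, zero_mul] at e1
            exact (mul_eq_zero.1 e1).resolve_left hne
          exact ⟨h1, h2, by rw [hb i k, h1, map_zero], by rw [hb j k, h2, map_zero]⟩
        have hkl0 : ∀ k l, k ≠ i → k ≠ j → l ≠ i → l ≠ j → b k l = 0 := by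
          intro k l hki hkj hli hlj
          have e := ho i k j l hki.symm (fun h => hij h.1) (fun h => hli h.1.symm)
          rw [(hik l hli hlj).1, zero_mul] at e
          exact (mul_eq_zero.1 e).resolve_left hne
        have cst : ∀ m r, m ≠ r → b r r = 0 → b m r = 0 → a m * a r = 1 := by
          intro m r hmr h1 h2
          have h3 : ((a m * a r : ℝ) : ℂ) = ((1 : ℝ) : ℂ) := by
            have := hd m r hmr
            rw [h1, h2] at this
            push_cast
            linear_combination this
          exact Complex.ofReal_injective h3
        have kk := hkl0 k k hki hkj hki hkj
        have ll := hkl0 l l hli hlj hli hlj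
        have c1 := cst i k hki.symm kk (hik k hki hkj).1
        have c2 := cst j k hkj.symm kk (hik k hki hkj).2.1
        have c3 := cst i l hli.symm ll (hik l hli hlj).1
        have c4 := cst j l hlj.symm ll (hik l hli hlj).2.1
        have c5 := cst k l hkl ll (hkl0 k l hki hkj hli hlj)
        have c6 : a i * a j = 1 := by
          have e1 : a i = a l := by linear_combination -a i * c5 + a l * c1
          have e2 : a j = a k := by linear_combination -a j * c5 + a k * c4
          rw [e1, e2]; linarith
        apply hdet
        have c7 : ((a i * a j : ℝ) : ℂ) = ((1 : ℝ) : ℂ) := by rw [c6]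
        push_cast at c7
        linear_combination hd i j hij - c7
    obtain ⟨k, l, hki, hkj, hli, hlj, hkl⟩ := exists_other hn i j
    have hsq : ∀ m, a i * a m = 1 := by
      intro m
      by_cases hm : i = m
      · subst hm
        have h1 := key i k hki.symm
        have h2 := key i l hli.symm
        have h3 := key k l hkl
        have : a i = a k := by linear_combination -a i * h3 + a k * h2
        rw [← this] at h1; exact h1
      · exact key i m hm
    refine ⟨a i, 0, by have := hsq i; nlinarith, fun m r => ?_⟩
    by_cases hmr : m = r
    · have : ((a i * a m : ℝ) : ℂ) = ((1 : ℝ) : ℂ) := by rw [hsq m]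
      push_cast at this
      simp [hmr]
      rw [← hmr]; exact this
    · simp [hmr]

lemma mat_sym {n : ℕ} (hn : 4 ≤ n) (b : Fin n → Fin n → ℂ) (x y : Fin n → ℂ)
    (hm : ∀ i j k l, b i k * b j l = b i l * b j k)
    (he : ∀ i j l, x i * (if j = l then 1 else 0) + y i * b j l
      = x j * (if i = l then 1 else 0) + y j * b i l) (i : Fin n) : x i = 0 := by
  obtain ⟨k, l, hki, -, hli, -, hkl⟩ := exists_other hn i i
  have main : ∀ j l, j ≠ i → l ≠ i → j ≠ l → x i * b i l = 0 := by
    intro j l hji hli hjl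
    have e1 := he i j j
    have e2 := he i j l
    simp only [if_true, hji.symm, hli.symm, hjl, if_false] at e1 e2
    linear_combination b i l * e1 - b i j * e2 + y i * hm i j j l
  have h1 := main k l hki hli hkl
  have h2 := main l k hli hki hkl.symm
  by_contra hx
  have b1 : b i l = 0 := (mul_eq_zero.1 h1).resolve_left hx
  have b2 : b i k = 0 := (mul_eq_zero.1 h2).resolve_left hx
  have e1 := he i k k
  have e2 := he i l l
  have e3 := he i k l
  simp only [if_true, hki.symm, hli.symm, hkl, if_false, b1, b2] at e1 e2 e3
  have h3 := hm k l k l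
  apply hx
  have : x i * x i = 0 := by
    linear_combination x i * e1 - y i * b k k * e2 + y i ^ 2 * h3 + y i * b l k * e3
  exact mul_self_eq_zero.1 this

lemma frame {V : Type*} [NormedAddCommGroup V] [InnerProductSpace ℝ V] [FiniteDimensional ℝ V]
    (n : ℕ) (hV : Module.finrank ℝ V = 2 * n)
    (J : V →ₗ[ℝ] V) (hJ2 : ∀ X : V, J (J X) = -X)
    (hJorth : ∀ X Y : V, ⟪J X, J Y⟫ = ⟪X, Y⟫)
    (A : V →ₗ[ℝ] V) (hA : A.IsSymmetric) (hAJ : ∀ X, A (J X) = J (A X)) :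
    ∀ k ≤ n, ∃ (e : Fin k → V) (a : Fin k → ℝ), (∀ i, A (e i) = a i • e i) ∧
      (∀ i j, ⟪e i, e j⟫ = if i = j then (1 : ℝ) else 0) ∧ (∀ i j, ⟪e i, J (e j)⟫ = 0) := by
  have hskew : ∀ X Y : V, ⟪J X, Y⟫ = -⟪X, J Y⟫ := by
    intro X Y
    have := hJorth X (J Y)
    rw [hJ2, inner_neg_right] at this
    linarith
  have hself : ∀ X : V, ⟪X, J X⟫ = 0 := by
    intro X
    have := hskew X X
    rw [real_inner_comm] at this
    linarith
  intro k
  induction k with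
  | zero => exact fun _ => ⟨Fin.elim0, Fin.elim0, fun i => i.elim0, fun i => i.elim0, fun i => i.elim0⟩
  | succ k ih =>
    intro hk
    obtain ⟨e, a, h1, h2, h3⟩ := ih (by omega)
    set f : Fin k ⊕ Fin k → V := Sum.elim e (fun i => J (e i)) with hf
    set S := Submodule.span ℝ (Set.range f) with hS
    have hdim : Module.finrank ℝ S ≤ 2 * k := by
      have := finrank_range_le_card (R := ℝ) f
      simp only [Fintype.card_sum, Fintype.card_fin] at this
      unfold Set.finrank at this
      rw [← hS] at this
      omega
    have hmem : ∀ X : V, X ∈ Sᗮ ↔ (∀ i, ⟪e i, X⟫ = 0) ∧ ∀ i, ⟪J (e i), X⟫ = 0 := by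
      intro X
      constructor
      · intro h
        rw [Submodule.mem_orthogonal] at h
        exact ⟨fun i => h _ (Submodule.subset_span ⟨Sum.inl i, rfl⟩),
          fun i => h _ (Submodule.subset_span ⟨Sum.inr i, rfl⟩)⟩
      · rintro ⟨ha, hb⟩
        rw [Submodule.mem_orthogonal]
        intro u hu
        induction hu using Submodule.span_induction with
        | mem x hx =>
          obtain ⟨i | i, rfl⟩ := hx
          · exact ha i
          · exact hb i
        | zero => simp
        | add x y _ _ hx hy => rw [inner_add_left, hx, hy, add_zero]
        | smul c x _ hx => rw [inner_smul_left, hx, mul_zero]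
    have hinv : ∀ X ∈ Sᗮ, A X ∈ Sᗮ := by
      intro X hX
      rw [hmem] at hX ⊢
      constructor
      · intro i
        rw [← hA, h1, inner_smul_left, hX.1, mul_zero]
      · intro i
        rw [← hA, hAJ, h1, map_smul, inner_smul_left, hX.2, mul_zero]
    have hnt : Nontrivial Sᗮ := by
      have := Submodule.finrank_add_finrank_orthogonal S
      apply Module.nontrivial_of_finrank_pos (R := ℝ)
      omega
    have hsym := hA.restrict_invariant hinv
    have hev := hsym.hasEigenvalue_iSup_of_finiteDimensional
    obtain ⟨⟨v, hvS⟩, hv⟩ := hev.exists_hasEigenvector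
    set μ := (⨆ x : { x : Sᗮ // x ≠ 0 }, RCLike.re ⟪(A.restrict hinv) (x : Sᗮ), x⟫ / ‖(x : Sᗮ)‖ ^ 2 : ℝ)
    have hv1 : A v = μ • v := by
      have := congrArg Subtype.val hv.apply_eq_smul
      exact this
    have hv0 : v ≠ 0 := fun h => hv.2 (Subtype.ext h)
    rw [hmem] at hvS
    have hn0 : ‖v‖ ≠ 0 := norm_ne_zero_iff.2 hv0
    set w := ‖v‖⁻¹ • v with hw
    have hww : ⟪w, w⟫ = (1 : ℝ) := by
      rw [hw, inner_smul_left, inner_smul_right, real_inner_self_eq_norm_sq]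
      simp only [conj_trivial]
      field_simp
    have hew : ∀ i, ⟪e i, w⟫ = 0 := fun i => by rw [hw, inner_smul_right, hvS.1, mul_zero]
    have hjew : ∀ i, ⟪J (e i), w⟫ = 0 := fun i => by rw [hw, inner_smul_right, hvS.2, mul_zero]
    refine ⟨Fin.cons w e, Fin.cons μ a, ?_, ?_, ?_⟩
    · intro i
      refine Fin.cases ?_ (fun i => ?_) i
      · simp only [Fin.cons_zero]
        rw [hw, map_smul, hv1, smul_comm]
      · simpa using h1 i
    · intro i j
      refine Fin.cases ?_ (fun i => ?_) i <;> refine Fin.cases ?_ (fun j => ?_) j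
      · simpa using hww
      · simp only [Fin.cons_zero, Fin.cons_succ]
        rw [real_inner_comm, hew, if_neg (Fin.succ_ne_zero j).symm]
      · simp only [Fin.cons_zero, Fin.cons_succ]
        rw [hew, if_neg (Fin.succ_ne_zero i)]
      · simpa using h2 i j
    · intro i j
      refine Fin.cases ?_ (fun i => ?_) i <;> refine Fin.cases ?_ (fun j => ?_) j
      · simpa using hself w
      · simp only [Fin.cons_zero, Fin.cons_succ]
        rw [real_inner_comm, hjew]
      · simp only [Fin.cons_zero, Fin.cons_succ]
        have := hskew (e i) w
        rw [hjew] at this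
        linarith
      · simpa using h3 i j

/-- The (1,1)-part of a real bilinear form. -/
noncomputable def hh {V : Type*} [AddCommGroup V] [Module ℝ V] (J : V →ₗ[ℝ] V)
    (p : V →ₗ[ℝ] V →ₗ[ℝ] ℝ) (X Y : V) : ℂ :=
  ⟨(p X Y + p (J X) (J Y)) / 2, (p X (J Y) - p (J X) Y) / 2⟩

/-- The (2,0)-part of a real bilinear form. -/
noncomputable def ss {V : Type*} [AddCommGroup V] [Module ℝ V] (J : V →ₗ[ℝ] V)
    (p : V →ₗ[ℝ] V →ₗ[ℝ] ℝ) (X Y : V) : ℂ :=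
  ⟨(p X Y - p (J X) (J Y)) / 2, -(p X (J Y) + p (J X) Y) / 2⟩

lemma eq_three {V : Type*} [AddCommGroup V] [Module ℝ V] (J : V →ₗ[ℝ] V)
  (hJ2 : ∀ X : V, J (J X) = -X) (p q g : V →ₗ[ℝ] V →ₗ[ℝ] ℝ)
  (K : ∀ X Y Z W, p W X * p Z Y + q W X * q Z Y - g W X * g Z Y
      - (p Z X * p W Y + q Z X * q W Y - g Z X * g W Y)
    = p (J W) X * p (J Z) Y + q (J W) X * q (J Z) Y - g (J W) X * g (J Z) Y
      - (p (J Z) X * p (J W) Y + q (J Z) X * q (J W) Y - g (J Z) X * g (J W) Y))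
   (X Y Z W : V) :
    hh J p W X * hh J p Z Y + hh J q W X * hh J q Z Y - hh J g W X * hh J g Z Y
    = hh J p Z X * hh J p W Y + hh J q Z X * hh J q W Y - hh J g Z X * hh J g W Y := by
  have k1 := K X Y Z W
  have k2 := K (J X) (J Y) Z W
  have k3 := K X (J Y) (J Z) W
  have k4 := K (J X) Y (J Z) W
  have m1 := K X (J Y) Z W
  have m2 := K (J X) Y Z W
  have m3 := K X Y (J Z) W
  have m4 := K (J X) (J Y) (J Z) W
  simp only [hJ2, map_neg, LinearMap.neg_apply] at k1 k2 k3 k4 m1 m2 m3 m4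
  apply Complex.ext
  · simp only [hh, Complex.add_re, Complex.sub_re, Complex.mul_re]
    linear_combination (k1 - k2 + k3 + k4) / 4
  · simp only [hh, Complex.add_im, Complex.sub_im, Complex.mul_im]
    linear_combination (m1 + m2 - m3 + m4) / 4

lemma eq_two {V : Type*} [AddCommGroup V] [Module ℝ V] (J : V →ₗ[ℝ] V)
  (hJ2 : ∀ X : V, J (J X) = -X) (p q g : V →ₗ[ℝ] V →ₗ[ℝ] ℝ)
  (K : ∀ X Y Z W, p W X * p Z Y + q W X * q Z Y - g W X * g Z Y
      - (p Z X * p W Y + q Z X * q W Y - g Z X * g W Y)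
    = p (J W) X * p (J Z) Y + q (J W) X * q (J Z) Y - g (J W) X * g (J Z) Y
      - (p (J Z) X * p (J W) Y + q (J Z) X * q (J W) Y - g (J Z) X * g (J W) Y))
   (X Y Z W : V) :
    ss J p W X * hh J p Z Y + ss J q W X * hh J q Z Y - ss J g W X * hh J g Z Y
    = ss J p Z X * hh J p W Y + ss J q Z X * hh J q W Y - ss J g Z X * hh J g W Y := by
  have k1 := K X Y Z W
  have k2 := K (J X) (J Y) Z W
  have k3 := K X (J Y) (J Z) W
  have k4 := K (J X) Y (J Z) W
  have m1 := K X (J Y) Z W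
  have m2 := K (J X) Y Z W
  have m3 := K X Y (J Z) W
  have m4 := K (J X) (J Y) (J Z) W
  simp only [hJ2, map_neg, LinearMap.neg_apply] at k1 k2 k3 k4 m1 m2 m3 m4
  apply Complex.ext
  · simp only [hh, ss, Complex.add_re, Complex.sub_re, Complex.mul_re]
    linear_combination (k1 + k2 + k3 - k4) / 4
  · simp only [hh, ss, Complex.add_im, Complex.sub_im, Complex.mul_im]
    linear_combination (m1 - m2 - m3 - m4) / 4

lemma exists_op {V : Type*} [NormedAddCommGroup V] [InnerProductSpace ℝ V]
    [FiniteDimensional ℝ V] (P : V →ₗ[ℝ] V →ₗ[ℝ] ℝ) :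
    ∃ A : V →ₗ[ℝ] V, ∀ X Y, ⟪A X, Y⟫ = P X Y := by
  let v := stdOrthonormalBasis ℝ V
  refine ⟨∑ i, (P.flip (v i)).smulRight (v i), fun X Y => ?_⟩
  conv_rhs => rw [← v.sum_repr' Y]
  simp [sum_inner, inner_smul_left, mul_comm]

/-- pointwise algebraic core of Theorem 1 (codimension 2, n ≥ 4). -/
theorem stmt_5
    (V N : Type*) [NormedAddCommGroup V] [InnerProductSpace ℝ V] [FiniteDimensional ℝ V]
    [NormedAddCommGroup N] [InnerProductSpace ℝ N] [FiniteDimensional ℝ N]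
    (n : ℕ) (hn : 4 ≤ n)
    (hV : Module.finrank ℝ V = 2 * n) (hN : Module.finrank ℝ N = 2)
    (J : V →ₗ[ℝ] V) (hJ2 : ∀ X : V, J (J X) = -X)
    (hJorth : ∀ X Y : V, ⟪J X, J Y⟫ = ⟪X, Y⟫)
    (α : V →ₗ[ℝ] V →ₗ[ℝ] N) (hαsymm : ∀ X Y : V, α X Y = α Y X)
    (hKaehler : ∀ X Y Z W : V,
      gaussR (-1) α X Y (J Z) (J W) = gaussR (-1) α X Y Z W)
    (hnotflat : ∃ X Y Z W : V, gaussR (-1) α X Y Z W ≠ 0) :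
    ∃ δ : N, ‖δ‖ = 1 ∧ ∀ X Y : V, ⟪α X Y, δ⟫ = ⟪X, Y⟫ := by
  have hskew : ∀ X Y : V, ⟪J X, Y⟫ = -⟪X, J Y⟫ := by
    intro X Y
    have := hJorth X (J Y)
    rw [hJ2, inner_neg_right] at this
    linarith
  let φ : OrthonormalBasis (Fin 2) ℝ N := (stdOrthonormalBasis ℝ N).reindex (finCongr hN)
  let p : V →ₗ[ℝ] V →ₗ[ℝ] ℝ := α.compr₂ (innerₗ N (φ 0))
  let q : V →ₗ[ℝ] V →ₗ[ℝ] ℝ := α.compr₂ (innerₗ N (φ 1))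
  let g : V →ₗ[ℝ] V →ₗ[ℝ] ℝ := innerₗ V
  have hp : ∀ X Y, p X Y = ⟪φ 0, α X Y⟫ := fun X Y => rfl
  have hq : ∀ X Y, q X Y = ⟪φ 1, α X Y⟫ := fun X Y => rfl
  have hg : ∀ X Y, g X Y = ⟪X, Y⟫ := fun X Y => rfl
  have psymm : ∀ X Y, p X Y = p Y X := fun X Y => by rw [hp, hp, hαsymm]
  have qsymm : ∀ X Y, q X Y = q Y X := fun X Y => by rw [hq, hq, hαsymm]
  have gsymm : ∀ X Y, g X Y = g Y X := fun X Y => by rw [hg, hg, real_inner_comm]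
  have hin : ∀ X Y Z W, ⟪α X Y, α Z W⟫ = p X Y * p Z W + q X Y * q Z W := by
    intro X Y Z W
    rw [← φ.sum_inner_mul_inner, Fin.sum_univ_two, hp, hp, hq, hq, real_inner_comm (α X Y) (φ 0),
      real_inner_comm (α X Y) (φ 1)]
  have K : ∀ X Y Z W, p W X * p Z Y + q W X * q Z Y - g W X * g Z Y
      - (p Z X * p W Y + q Z X * q W Y - g Z X * g W Y)
    = p (J W) X * p (J Z) Y + q (J W) X * q (J Z) Y - g (J W) X * g (J Z) Y
      - (p (J Z) X * p (J W) Y + q (J Z) X * q (J W) Y - g (J Z) X * g (J W) Y) := by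
    intro X Y Z W
    have := hKaehler X Y Z W
    unfold gaussR at this
    simp only [hin, ← hg] at this
    rw [psymm X W, psymm Y Z, psymm X Z, psymm Y W, psymm X (J W), psymm Y (J Z), psymm X (J Z),
      psymm Y (J W), qsymm X W, qsymm Y Z, qsymm X Z, qsymm Y W, qsymm X (J W), qsymm Y (J Z),
      qsymm X (J Z), qsymm Y (J W), gsymm X W, gsymm Y Z, gsymm X Z, gsymm Y W, gsymm X (J W),
      gsymm Y (J Z), gsymm X (J Z), gsymm Y (J W)] at this
    linear_combination -this
  have E3 := eq_three J hJ2 p q g K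
  have E2 := eq_two J hJ2 p q g K
  obtain ⟨A, hAP⟩ := exists_op ((1 / 2 : ℝ) • (p + p.compl₁₂ J J))
  have hAform : ∀ X Y, ⟪A X, Y⟫ = (p X Y + p (J X) (J Y)) / 2 := by
    intro X Y
    rw [hAP]
    simp
    ring
  have hAs : A.IsSymmetric := by
    intro X Y
    rw [hAform, real_inner_comm, hAform, psymm X Y, psymm (J X)]
  have hAJ : ∀ X, A (J X) = J (A X) := by
    intro X
    refine ext_inner_right ℝ fun Y => ?_
    rw [hskew, hAform, hAform, hJ2, hJ2]
    simp only [map_neg, LinearMap.neg_apply]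
    ring
  obtain ⟨e, a, he1, he2, he3⟩ := frame n hV J hJ2 hJorth A hAs hAJ n le_rfl
  have Hp : ∀ i j, hh J p (e i) (e j) = if i = j then (a i : ℂ) else 0 := by
    intro i j
    have r1 := hAform (e i) (e j)
    have r2 := hAform (e i) (J (e j))
    rw [he1, inner_smul_left, he2] at r1
    rw [he1, inner_smul_left, he3, hJ2, map_neg] at r2
    apply Complex.ext
    · simp only [hh]
      rw [← r1]
      split_ifs <;> simp
    · simp only [hh]
      rw [sub_eq_add_neg, ← r2]
      split_ifs <;> simp
  have Hg : ∀ i j, hh J g (e i) (e j) = if i = j then 1 else 0 := by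
    intro i j
    apply Complex.ext
    · simp only [hh, hg, hJorth, he2]
      split_ifs <;> simp
    · simp only [hh, hg, hskew, he3]
      split_ifs <;> simp
  have Sg : ∀ X Y, ss J g X Y = 0 := by
    intro X Y
    apply Complex.ext
    · simp [ss, hg, hJorth]
    · simp [ss, hg, hskew]
  have Hq : ∀ i j, hh J q (e j) (e i) = (starRingEnd ℂ) (hh J q (e i) (e j)) := by
    intro i j
    apply Complex.ext
    · simp only [hh, Complex.conj_re]
      rw [qsymm (e j), qsymm (J (e j))]
    · simp only [hh, Complex.conj_im]
      rw [qsymm (e j), qsymm (J (e j))]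
      ring
  obtain ⟨c, s, hcs, T⟩ := mat_core hn a (fun i j => hh J q (e i) (e j)) Hq
    (by
      intro i j hij
      have := E3 (e i) (e j) (e j) (e i)
      simp only [Hp, Hg, if_true, hij, hij.symm, if_false] at this
      linear_combination this)
    (by
      intro i j k l hij h1 h2
      have := E3 (e k) (e l) (e j) (e i)
      simp only [Hp, Hg] at this
      have z1 : ∀ x y : ℂ, (if i = k then x else 0) * (if j = l then y else 0) = 0 := by
        intro x y
        split_ifs with u1 u2
        · exact absurd ⟨u1, u2⟩ h1
        all_goals simp
      have z2 : ∀ x y : ℂ, (if j = k then x else 0) * (if i = l then y else 0) = 0 := by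
        intro x y
        split_ifs with u1 u2
        · exact absurd ⟨u2, u1⟩ h2
        all_goals simp
      rw [z1, z1, z2, z2] at this
      linear_combination this)
  have hcsC : (c : ℂ) ^ 2 + (s : ℂ) ^ 2 = 1 := by exact_mod_cast hcs
  have TT : ∀ i j, (c : ℂ) * hh J p (e i) (e j) + s * hh J q (e i) (e j)
      = hh J g (e i) (e j) := by
    intro i j
    rw [Hp, Hg]
    exact T i j
  have hx : ∀ k i, (c : ℂ) * ss J p (e i) (e k) + s * ss J q (e i) (e k) = 0 := by
    intro k i
    refine mat_sym hn (fun i j => -(s : ℂ) * hh J p (e i) (e j) + c * hh J q (e i) (e j))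
      (fun i => (c : ℂ) * ss J p (e i) (e k) + s * ss J q (e i) (e k))
      (fun i => -(s : ℂ) * ss J p (e i) (e k) + c * ss J q (e i) (e k)) ?_ ?_ i
    · intro i j k l
      have h := E3 (e k) (e l) (e j) (e i)
      have T1 := TT i k
      have T2 := TT j l
      have T3 := TT j k
      have T4 := TT i l
      generalize hh J p (e i) (e k) = A1 at *
      generalize hh J p (e j) (e l) = A2 at *
      generalize hh J p (e j) (e k) = A3 at *
      generalize hh J p (e i) (e l) = A4 at *
      generalize hh J q (e i) (e k) = B1 at *
      generalize hh J q (e j) (e l) = B2 at *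
      generalize hh J q (e j) (e k) = B3 at *
      generalize hh J q (e i) (e l) = B4 at *
      generalize hh J g (e i) (e k) = G1 at *
      generalize hh J g (e j) (e l) = G2 at *
      generalize hh J g (e j) (e k) = G3 at *
      generalize hh J g (e i) (e l) = G4 at *
      linear_combination h + (A1 * A2 + B1 * B2 - A3 * A4 - B3 * B4) * hcsC
        - ((c * A2 + s * B2) * T1 + G1 * T2) + ((c * A4 + s * B4) * T3 + G3 * T4)
    · intro i j l
      have h := E2 (e k) (e l) (e j) (e i)
      rw [Sg, Sg] at h
      simp only [← Hg, ← TT]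
      linear_combination h * (c ^ 2 + s ^ 2)
  set δ : N := c • φ 0 + s • φ 1 with hδ
  have hr : ∀ X Y, ⟪α X Y, δ⟫ = c * p X Y + s * q X Y := by
    intro X Y
    rw [hδ, inner_add_right, inner_smul_right, inner_smul_right, hp, hq, real_inner_comm,
      real_inner_comm (α X Y) (φ 1)]
  refine ⟨δ, ?_, ?_⟩
  · have h00 := φ.inner_eq_ite 0 0
    have h01 := φ.inner_eq_ite 0 1
    have h10 := φ.inner_eq_ite 1 0
    have h11 := φ.inner_eq_ite 1 1
    simp at h00 h01 h10 h11
    have : ‖δ‖ ^ 2 = 1 := by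
      rw [← real_inner_self_eq_norm_sq, hδ]
      simp only [inner_add_left, inner_add_right, inner_smul_left, inner_smul_right,
        real_inner_self_eq_norm_sq]
      simp
      linarith
    have h0 := norm_nonneg δ
    nlinarith
  · have horth : Orthonormal ℝ (Sum.elim e (fun i => J (e i)) : Fin n ⊕ Fin n → V) := by
      rw [orthonormal_iff_ite]
      rintro (i | i) (j | j)
      · simp [he2]
      · simp [he3]
      · simp [hskew, he3]
      · simp [hJorth, he2]
    have : Nonempty (Fin n ⊕ Fin n) := ⟨Sum.inl ⟨0, by omega⟩⟩
    let f := basisOfOrthonormalOfCardEqFinrank horth (by simp [hV]; ring)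
    have hf : ∀ i, f i = (Sum.elim e (fun i => J (e i)) : Fin n ⊕ Fin n → V) i := fun i => by
      simp [f]
    have hmain : c • p + s • q = g := by
      refine LinearMap.ext_basis f f fun i j => ?_
      rw [hf, hf]
      have key : ∀ i j : Fin n, (c * p (e i) (e j) + s * q (e i) (e j) = g (e i) (e j)) ∧
          (c * p (J (e i)) (J (e j)) + s * q (J (e i)) (J (e j)) = g (J (e i)) (J (e j))) ∧
          (c * p (e i) (J (e j)) + s * q (e i) (J (e j)) = g (e i) (J (e j))) ∧
          (c * p (J (e i)) (e j) + s * q (J (e i)) (e j) = g (J (e i)) (e j)) := by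
        intro i j
        have t1 := congrArg Complex.re (TT i j)
        have t2 := congrArg Complex.im (TT i j)
        have t3 := congrArg Complex.re (hx j i)
        have t4 := congrArg Complex.im (hx j i)
        simp only [hh, ss, Complex.add_re, Complex.add_im, Complex.re_ofReal_mul,
          Complex.im_ofReal_mul, Complex.zero_re, Complex.zero_im] at t1 t2 t3 t4
        have g1 : g (J (e i)) (J (e j)) = g (e i) (e j) := hJorth _ _
        have g2 : g (J (e i)) (e j) = - g (e i) (J (e j)) := hskew _ _
        refine ⟨?_, ?_, ?_, ?_⟩ <;> linarith
      rcases i with i | i <;> rcases j with j | j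
      · simpa using (key i j).1
      · simpa using (key i j).2.2.1
      · simpa using (key i j).2.2.2
      · simpa using (key i j).2.1
    intro X Y
    rw [hr, ← hg, ← hmain]
    simp
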